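/- Let X be a regular curve and f : X → X a homeomorphism with at least one wandering point. Then the induced map 2^f on the hyperspace of nonempty closed subsets of X satisfies h_pol(2^f) = +∞. -/

import Mathlib

open Filter Topology TopologicalSpace Set
open scoped ENNReal NNReal

variable {X : Type*}

/-- The dynamical (Bowen) distance `d_n^f(x,y) = max_{0 ≤ k ≤ n-1} d(f^k x, f^k y)`. -/
noncomputable def dynDist [PseudoMetricSpace X] (f : X → X) (n : ℕ) (x y : X) : ℝ :=
  (((Finset.range n).sup fun k => nndist (f^[k] x) (f^[k] y) : ℝ≥0) : ℝ)

/-- `E` is `(n, ε)`-separated for `f`: distinct points of `E` are at `d_n^f`-distance `≥ ε`. -/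
def IsDynSeparated [PseudoMetricSpace X] (f : X → X) (n : ℕ) (ε : ℝ) (E : Set X) : Prop :=
  ∀ x ∈ E, ∀ y ∈ E, x ≠ y → ε ≤ dynDist f n x y

/-- `sep(n, ε)`: the maximal cardinality of a finite `(n, ε)`-separated set. -/
noncomputable def sepCount [PseudoMetricSpace X] (f : X → X) (n : ℕ) (ε : ℝ) : ℕ∞ :=
  ⨆ (E : Finset X) (_ : IsDynSeparated f n ε (E : Set X)), (E.card : ℕ∞)

/-- `limsup_{n → ∞} log (u n) / log n`, valued in `[0, ∞]`. -/
noncomputable def polGrowth (u : ℕ → ℕ∞) : ℝ≥0∞ :=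
  Filter.atTop.limsup fun n =>
    if u n = ⊤ then ⊤ else ENNReal.ofReal (Real.log ((u n).toNat : ℝ) / Real.log n)

/-- Polynomial entropy: `lim_{ε → 0⁺} limsup_{n → ∞} log sep(n,ε) / log n`; since the inner
quantity is antitone in `ε`, the limit as `ε → 0⁺` equals the supremum over `ε > 0`. -/
noncomputable def hpol [PseudoMetricSpace X] (f : X → X) : ℝ≥0∞ :=
  ⨆ (ε : ℝ) (_ : 0 < ε), polGrowth fun n => sepCount f n ε

/-- The regularity condition for a regular curve: every point has arbitrarily small open
neighbourhoods with finite topological boundary. (The requirement that `X` be a continuum,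
i.e. a nonempty compact connected metric space, is imposed via instance arguments.) -/
def IsRegularCurve (X : Type*) [TopologicalSpace X] : Prop :=
  ∀ x : X, ∀ U : Set X, IsOpen U → x ∈ U →
    ∃ V : Set X, IsOpen V ∧ x ∈ V ∧ V ⊆ U ∧ (frontier V).Finite

/-- A wandering point: some open neighbourhood `U` of `p` satisfies `f^n(U) ∩ U = ∅` for all
`n ≥ 1`. -/
def IsWanderingPoint [TopologicalSpace X] (f : X → X) (p : X) : Prop :=
  ∃ U : Set X, IsOpen U ∧ p ∈ U ∧ ∀ n : ℕ, 1 ≤ n → f^[n] '' U ∩ U = ∅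

/-- The induced map `2^f : A ↦ f(A)` on the hyperspace of nonempty closed subsets of a compact
metric space (equivalently, nonempty compact subsets), with the Hausdorff metric. -/
noncomputable def hyperMap [TopologicalSpace X] (f : X → X) (hf : Continuous f) :
    NonemptyCompacts X → NonemptyCompacts X :=
  fun A => ⟨⟨f '' (A : Set X), A.isCompact.image hf⟩, A.nonempty.image f⟩

/-- Sequences dominating `2 ^ n` have infinite polynomial growth. -/
theorem polGrowth_eq_top_of_two_pow_le {u : ℕ → ℕ∞} (hu : ∀ n, ((2 ^ n : ℕ) : ℕ∞) ≤ u n) :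
    polGrowth u = ⊤ := by
  have hdiv : Tendsto (fun n : ℕ => (n : ℝ) / Real.log n) atTop atTop := by
    have h0 : Tendsto (fun x : ℝ => Real.log x / x) atTop (𝓝[>] 0) := by
      refine tendsto_nhdsWithin_iff.2 ⟨Real.isLittleO_log_id_atTop.tendsto_div_nhds_zero, ?_⟩
      filter_upwards [eventually_gt_atTop 1] with x hx
      exact div_pos (Real.log_pos hx) (by linarith)
    refine (h0.inv_tendsto_nhdsGT_zero.comp tendsto_natCast_atTop_atTop).congr fun n => ?_
    simp
  have hlim : Tendsto (fun n : ℕ => ENNReal.ofReal ((n : ℝ) / Real.log n * Real.log 2))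
      atTop (𝓝 ⊤) :=
    ENNReal.tendsto_ofReal_atTop.comp (hdiv.atTop_mul_const (Real.log_pos one_lt_two))
  refine Tendsto.limsup_eq (tendsto_nhds_top_mono' hlim fun n => ?_)
  beta_reduce
  split_ifs with h
  · exact le_top
  · refine ENNReal.ofReal_le_ofReal ?_
    have hle : (2 : ℝ) ^ n ≤ ((u n).toNat : ℝ) := by
      have := ENat.toNat_le_toNat (hu n) h
      rw [ENat.toNat_natCast] at this
      exact_mod_cast this
    rw [div_mul_eq_mul_div, ← Real.log_pow]
    exact div_le_div_of_nonneg_right (Real.log_le_log (by positivity) hle)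
      (Real.log_natCast_nonneg n)

theorem dist_iterate_le_dynDist [PseudoMetricSpace X] (f : X → X) {n k : ℕ} (hk : k < n)
    (x y : X) : dist (f^[k] x) (f^[k] y) ≤ dynDist f n x y := by
  have := Finset.le_sup (f := fun k => nndist (f^[k] x) (f^[k] y)) (Finset.mem_range.2 hk)
  exact_mod_cast this

/-- A finite family with pairwise dynamical distances at least `ε > 0` bounds `sepCount` below. -/
theorem card_le_sepCount [PseudoMetricSpace X] {ι : Type*} (f : X → X) {n : ℕ} {ε : ℝ}
    (hε : 0 < ε) (s : Finset ι) (F : ι → X)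
    (hF : ∀ i ∈ s, ∀ j ∈ s, i ≠ j → ε ≤ dynDist f n (F i) (F j)) :
    (s.card : ℕ∞) ≤ sepCount f n ε := by
  classical
  have hinj : Set.InjOn F s := by
    intro i hi j hj hij
    by_contra hne
    have := hF i hi j hj hne
    rw [hij] at this
    refine (hε.trans_le this).ne' ?_
    simp only [dynDist, nndist_self, NNReal.coe_eq_zero]
    exact Finset.sup_bot _
  rw [← Finset.card_image_of_injOn hinj]
  refine le_iSup₂_of_le (s.image F) ?_ le_rfl
  intro x hx y hy hxy
  simp only [Finset.coe_image, Set.mem_image, Finset.mem_coe] at hx hy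
  obtain ⟨i, hi, rfl⟩ := hx
  obtain ⟨j, hj, rfl⟩ := hy
  exact hF i hi j hj fun h => hxy (congrArg F h)

theorem coe_hyperMap_iterate [TopologicalSpace X] (f : X → X) (hf : Continuous f) (k : ℕ)
    (A : NonemptyCompacts X) :
    (((hyperMap f hf)^[k] A : NonemptyCompacts X) : Set X) = f^[k] '' (A : Set X) := by
  induction k with
  | zero => simp
  | succ k ih =>
    rw [Function.iterate_succ_apply', Function.iterate_succ', Set.image_comp, ← ih]
    rfl

theorem NonemptyCompacts.le_dist_of_mem [MetricSpace X] {A B : NonemptyCompacts X} {x : X}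
    {ε : ℝ} (hx : x ∈ (A : Set X)) (h : ∀ y ∈ (B : Set X), ε ≤ dist x y) : ε ≤ dist A B := by
  rw [Metric.NonemptyCompacts.dist_eq]
  exact ((Metric.le_infDist B.nonempty).2 fun {y} hy => h y hy).trans
    (Metric.infDist_le_hausdorffDist_of_mem hx
      (Metric.hausdorffEDist_ne_top_of_nonempty_of_bounded A.nonempty B.nonempty
        A.isCompact.isBounded B.isCompact.isBounded))

/-- Polynomial entropy of the hyperspace map is infinite as soon as some point `q 0` has a
backward orbit `q` whose other orbit points stay away from `q 0`. -/
theorem hpol_hyperMap_eq_top_of_backward_orbit [MetricSpace X] {f : X → X} (hf : Continuous f)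
    (q : ℕ → X) {ε : ℝ} (hε : 0 < ε) (hq : ∀ i, f^[i] (q i) = q 0)
    (hfar : ∀ i j, i ≠ j → ε ≤ dist (q 0) (f^[j] (q i))) :
    hpol (hyperMap f hf) = ⊤ := by
  classical
  refine top_unique (le_iSup₂_of_le ε hε (polGrowth_eq_top_of_two_pow_le fun n => ?_).ge)
  let F : Finset ℕ → NonemptyCompacts X := fun S =>
    ⟨⟨q '' (insert n S : Finset ℕ), ((insert n S).finite_toSet.image q).isCompact⟩,
      ⟨q n, n, by simp, rfl⟩⟩
  have key : ∀ S T : Finset ℕ, ∀ j < n, j ∈ S → j ∉ T →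
      ε ≤ dist ((hyperMap f hf)^[j] (F S)) ((hyperMap f hf)^[j] (F T)) := by
    intro S T j hj hS hT
    refine NonemptyCompacts.le_dist_of_mem (x := q 0) ?_ ?_
    · rw [coe_hyperMap_iterate]
      exact ⟨q j, ⟨j, by simp [hS], rfl⟩, hq j⟩
    · rw [coe_hyperMap_iterate]
      rintro _ ⟨_, ⟨i, hi, rfl⟩, rfl⟩
      refine hfar i j ?_
      rintro rfl
      rcases Finset.mem_insert.1 (Finset.mem_coe.1 hi) with h | h
      · omega
      · exact hT h
  have := card_le_sepCount (hyperMap f hf) (n := n) hε (Finset.range n).powerset F ?_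
  · simpa using this
  intro S hS T hT hne
  rw [Finset.mem_powerset] at hS hT
  obtain ⟨j, hj⟩ : ∃ j, ¬ (j ∈ S ↔ j ∈ T) := by
    by_contra! h
    exact hne (Finset.ext h)
  by_cases hjS : j ∈ S
  · have hjT : j ∉ T := fun h => hj (iff_of_true hjS h)
    have hjn := Finset.mem_range.1 (hS hjS)
    exact (key S T j hjn hjS hjT).trans (dist_iterate_le_dynDist _ hjn _ _)
  · have hjT : j ∈ T := by
      by_contra h
      exact hj (iff_of_false hjS h)
    have hjn := Finset.mem_range.1 (hT hjT)
    refine (key T S j hjn hjT hjS).trans ?_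
    rw [dist_comm]
    exact dist_iterate_le_dynDist _ hjn _ _

/-- if a homeomorphism `f` of a regular curve has a wandering point, then the
induced map `2^f` on the hyperspace of nonempty closed subsets satisfies `h_pol(2^f) = +∞`. -/
theorem hpol_hyperMap_eq_top_of_isRegularCurve_of_wandering
    {X : Type*} [MetricSpace X] [CompactSpace X] [ConnectedSpace X] [Nonempty X]
    (hX : IsRegularCurve X) (f : X → X) (hf : IsHomeomorph f)
    (p : X) (hp : IsWanderingPoint f p) :
    hpol (hyperMap f hf.continuous) = ⊤ := by
  obtain ⟨U, hU, hpU, hwand⟩ := hp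
  obtain ⟨ε, hε, hball⟩ := Metric.isOpen_iff.1 hU p hpU
  have hdisj : ∀ m, 1 ≤ m → ∀ x ∈ U, f^[m] x ∉ U := fun m hm x hx hfx =>
    (Set.eq_empty_iff_forall_notMem.1 (hwand m hm)) _ ⟨⟨x, hx, rfl⟩, hfx⟩
  obtain ⟨g, hg⟩ := hf.surjective.hasRightInverse
  have hfg : ∀ i, f^[i] (g^[i] p) = p := fun i => hg.iterate i p
  refine hpol_hyperMap_eq_top_of_backward_orbit hf.continuous (fun i => g^[i] p) hε hfg ?_
  intro i j hij
  by_contra! hlt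
  have hmem : f^[j] (g^[i] p) ∈ U := hball (by rwa [Metric.mem_ball, dist_comm])
  rcases lt_or_gt_of_ne hij with h | h
  · refine hdisj (j - i) (by omega) p hpU ?_
    rwa [← hfg i, ← Function.iterate_add_apply, Nat.sub_add_cancel h.le]
  · refine hdisj (i - j) (by omega) _ hmem ?_
    rwa [← Function.iterate_add_apply, Nat.sub_add_cancel h.le, hfg i]
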